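/- For every positive integer k and every ε > 0 there exist finite sets S₁, S₂ ⊆ ℝ² in general position and points s, t, p, q with {s, t, p, q} ⊆ S₁ ∩ S₂ and s ≠ t, such that, writing G₁ and G₂ for the TD_{θ₁,θ₂}-Delaunay graphs of S₁ and S₂ respectively: (i) the set N of vertices reachable from s by at most k edges is the same in G₁ and G₂, and for all u, v ∈ N, u and v are adjacent in G₁ if and only if they are adjacent in G₂; (ii) in both G₁ and G₂ the neighbours of s are exactly p and q; (iii) every path from s to t in G₁ whose first edge is sp has total length at least (C(θ₁,θ₂) − ε)·‖s − t‖; and (iv) every path from s to t in G₂ whose first edge is sq has total length at least (C(θ₁,θ₂) − ε)·‖s − t‖. -/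

import Mathlib

noncomputable section

/-- The Euclidean plane. -/
abbrev Pt : Type := EuclideanSpace ℝ (Fin 2)

/-- The scaled translate `r•Δ + w` of a set `Δ`. -/
def scaledTranslate (Δ : Set Pt) (r : ℝ) (w : Pt) : Set Pt :=
  (fun x => r • x + w) '' Δ

/-- The triangle with corners `τ 0, τ 1, τ 2`. -/
def Tri (τ : Fin 3 → Pt) : Set Pt := convexHull ℝ (Set.range τ)

/-- Adjacency in the `Δ`-Delaunay graph of `S`: distinct `u, v ∈ S` are adjacent exactly
when some scaled translate of `Δ` has `u` and `v` on its boundary and no point of `S`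
in its interior. -/
def TDAdj (Δ : Set Pt) (S : Set Pt) (u v : Pt) : Prop :=
  u ∈ S ∧ v ∈ S ∧ u ≠ v ∧
    ∃ r : ℝ, 0 < r ∧ ∃ w : Pt,
      u ∈ frontier (scaledTranslate Δ r w) ∧
      v ∈ frontier (scaledTranslate Δ r w) ∧
      ∀ x ∈ S, x ∉ interior (scaledTranslate Δ r w)

/-- Length of a polygonal path given as a list of vertices. -/
def pathLength : List Pt → ℝ
  | [] => 0
  | [_] => 0
  | a :: b :: rest => ‖a - b‖ + pathLength (b :: rest)

/-- `P` is a path in the graph with adjacency `Adj` from `a` to `b`. -/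
def IsPathFrom (Adj : Pt → Pt → Prop) (a b : Pt) (P : List Pt) : Prop :=
  P ≠ [] ∧ P.head? = some a ∧ P.getLast? = some b ∧ P.Chain' Adj

/-- Graph distance: infimum of lengths of paths from `u` to `v`. -/
def dG (Adj : Pt → Pt → Prop) (u v : Pt) : ℝ :=
  sInf { L : ℝ | ∃ P : List Pt, IsPathFrom Adj u v P ∧ pathLength P = L }

/-- `S` is in general position: no two points of `S` determine a line parallel to a side
of the triangle with corners `τ 0, τ 1, τ 2`. -/
def GenPos (τ : Fin 3 → Pt) (S : Set Pt) : Prop :=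
  ∀ u ∈ S, ∀ v ∈ S, u ≠ v → ∀ i : Fin 3, ∀ c : ℝ, v - u ≠ c • (τ (i + 1) - τ i)

/-- The inner expression in the definition of `C(θ₁,θ₂)`. -/
def Cexpr (θ : Fin 3 → ℝ) (j : Fin 3) (α : ℝ) : ℝ :=
  Real.sin (θ j - α) / Real.sin (θ (j + 1)) + Real.sin α / Real.sin (θ (j - 1)) +
    min (Real.sin α / Real.sin (θ (j - 1)) + Real.sin (α + θ (j - 1)) / Real.sin (θ (j + 1)))
        (Real.sin (θ j - α) / Real.sin (θ (j + 1)) +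
          Real.sin (α + θ (j - 1)) / Real.sin (θ (j - 1)))

/-- `C(θ₁,θ₂)`: the maximum of `Cexpr θ j α` over `j ∈ {1,2,3}` and `α ∈ [0, θⱼ]`. -/
def Cval (θ : Fin 3 → ℝ) : ℝ :=
  sSup { x : ℝ | ∃ j : Fin 3, ∃ α : ℝ, α ∈ Set.Icc 0 (θ j) ∧ x = Cexpr θ j α }

/-- The positive cone `C_{p,i}`. -/
def posCone (τ : Fin 3 → Pt) (p : Pt) (i : Fin 3) : Set Pt :=
  { q | ∃ s r : ℝ, 0 ≤ s ∧ 0 ≤ r ∧ q = p + s • (τ (i + 1) - τ i) + r • (τ (i - 1) - τ i) }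

/-- The negative cone `C̄_{p,i}`. -/
def negCone (τ : Fin 3 → Pt) (p : Pt) (i : Fin 3) : Set Pt :=
  { q | ∃ s r : ℝ, 0 ≤ s ∧ 0 ≤ r ∧ q = p - s • (τ (i + 1) - τ i) - r • (τ (i - 1) - τ i) }

/-- Vertices reachable from `s` by a path with at most `k` edges. -/
def ReachK (Adj : Pt → Pt → Prop) (k : ℕ) (s : Pt) : Set Pt :=
  { v | ∃ P : List Pt, IsPathFrom Adj s v P ∧ P.length ≤ k + 1 }


/-! ### Barycentric description of the adjacency relation -/

lemma coord_smul_add (b : AffineBasis (Fin 3) ℝ Pt) (i : Fin 3) (r : ℝ) (x w : Pt) :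
    b.coord i (r • x + w) = r * b.coord i x + (b.coord i w - r * b.coord i 0) := by
  have h : ∀ y, b.coord i y = (b.coord i).linear y + b.coord i 0 := fun y => by
    have := congrFun (AffineMap.decomp' (b.coord i)) y
    simp only [Pi.sub_apply] at this
    linarith
  rw [h (r • x + w), h x, h w, map_add, map_smul, smul_eq_mul]
  ring

/-- The homeomorphism `x ↦ r • x + w`. -/
def scaleHomeo (r : ℝ) (hr : r ≠ 0) (w : Pt) : Pt ≃ₜ Pt :=
  (Homeomorph.smulOfNeZero r hr).trans (Homeomorph.addRight w)

lemma tri_eq (b : AffineBasis (Fin 3) ℝ Pt) : Tri b = {x | ∀ i, 0 ≤ b.coord i x} :=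
  b.convexHull_eq_nonneg_coord

lemma image_scale (r : ℝ) (hr : 0 < r) (w : Pt) (A : Set Pt) (y : Pt) :
    y ∈ (fun x => r • x + w) '' A ↔ r⁻¹ • (y - w) ∈ A := by
  constructor
  · rintro ⟨x, hx, rfl⟩
    simpa [smul_smul, hr.ne'] using hx
  · intro h
    exact ⟨_, h, by simp [smul_smul, hr.ne']⟩

lemma coord_scale (b : AffineBasis (Fin 3) ℝ Pt) (r : ℝ) (hr : 0 < r) (w y : Pt) (i : Fin 3) :
    b.coord i y = r * b.coord i (r⁻¹ • (y - w)) + (b.coord i w - r * b.coord i 0) := by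
  rw [← coord_smul_add]
  simp [smul_smul, hr.ne']

lemma mem_scaled (b : AffineBasis (Fin 3) ℝ Pt) (r : ℝ) (hr : 0 < r) (w y : Pt) :
    y ∈ scaledTranslate (Tri b) r w ↔
      ∀ i, b.coord i w - r * b.coord i 0 ≤ b.coord i y := by
  unfold scaledTranslate
  rw [image_scale r hr, tri_eq, Set.mem_ofPred_eq]
  refine forall_congr' fun i => ?_
  rw [coord_scale b r hr w y i]
  constructor
  · intro h; nlinarith
  · intro h; by_contra h'; push Not at h'; nlinarith

lemma mem_interior_scaled (b : AffineBasis (Fin 3) ℝ Pt) (r : ℝ) (hr : 0 < r) (w y : Pt) :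
    y ∈ interior (scaledTranslate (Tri b) r w) ↔
      ∀ i, b.coord i w - r * b.coord i 0 < b.coord i y := by
  have h1 : interior (scaledTranslate (Tri b) r w) =
      (fun x => r • x + w) '' interior (Tri b) :=
    ((scaleHomeo r hr.ne' w).image_interior (Tri b)).symm
  rw [h1, image_scale r hr]
  unfold Tri
  rw [b.interior_convexHull, Set.mem_ofPred_eq]
  refine forall_congr' fun i => ?_
  rw [coord_scale b r hr w y i]
  constructor
  · intro h; nlinarith
  · intro h; by_contra h'; push Not at h'; nlinarith

lemma isClosed_scaled (b : AffineBasis (Fin 3) ℝ Pt) (r : ℝ) (hr : 0 < r) (w : Pt) :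
    IsClosed (scaledTranslate (Tri b) r w) := by
  have h : scaledTranslate (Tri b) r w =
      ⋂ i, {y | b.coord i w - r * b.coord i 0 ≤ b.coord i y} := by
    ext y; rw [mem_scaled b r hr]; simp
  rw [h]
  exact isClosed_iInter fun i => isClosed_le continuous_const
    (AffineMap.continuous_of_finiteDimensional _)

lemma coord_comb (b : AffineBasis (Fin 3) ℝ Pt) (μ : Fin 3 → ℝ) (h : ∑ i, μ i = 1) (i : Fin 3) :
    b.coord i (∑ i, μ i • b i) = μ i := by
  rw [← Finset.affineCombination_eq_linear_combination Finset.univ b μ h]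
  exact b.coord_apply_combination_of_mem (Finset.mem_univ i) h

lemma exists_coord_le (b : AffineBasis (Fin 3) ℝ Pt) (u v : Pt) :
    ∃ i, b.coord i u ≤ b.coord i v := by
  by_contra! h
  have := Finset.sum_lt_sum_of_nonempty (s := Finset.univ) Finset.univ_nonempty
    (fun i _ => h i)
  simp [b.sum_coord_apply_eq_one] at this

/-- Adjacency only depends on the order of the barycentric coordinates. -/
lemma tdAdj_iff (b : AffineBasis (Fin 3) ℝ Pt) (S : Set Pt) (u v : Pt) :
    TDAdj (Tri b) S u v ↔ u ∈ S ∧ v ∈ S ∧ u ≠ v ∧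
      ∀ x ∈ S, ¬ ∀ i, min (b.coord i u) (b.coord i v) < b.coord i x := by
  unfold TDAdj
  refine and_congr_right fun hu => and_congr_right fun hv => and_congr_right fun huv => ?_
  constructor
  · rintro ⟨r, hr, w, h1, h2, h3⟩ x hx hdom
    apply h3 x hx
    rw [mem_interior_scaled b r hr]
    have h1' := (mem_scaled b r hr w u).1 ((isClosed_scaled b r hr w).frontier_subset h1)
    have h2' := (mem_scaled b r hr w v).1 ((isClosed_scaled b r hr w).frontier_subset h2)
    exact fun i => lt_of_le_of_lt (le_min (h1' i) (h2' i)) (hdom i)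
  · intro h
    set c : Fin 3 → ℝ := fun i => min (b.coord i u) (b.coord i v) with hc
    set r : ℝ := 1 - ∑ i, c i with hrdef
    have hsu := b.sum_coord_apply_eq_one u
    have hsv := b.sum_coord_apply_eq_one v
    have hr : 0 < r := by
      rw [hrdef, sub_pos, ← hsu]
      refine Finset.sum_lt_sum (fun i _ => min_le_left _ _) ?_
      by_contra! h'
      apply huv
      have hle : ∀ i ∈ Finset.univ, b.coord i u ≤ b.coord i v := fun i hi =>
        (h' i hi).trans (min_le_right _ _)
      apply b.ext_elem
      intro i
      exact (Finset.sum_eq_sum_iff_of_le hle).1 (hsu.trans hsv.symm) i (Finset.mem_univ i)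
    have hw : ∑ i, (c i + r * b.coord i 0) = 1 := by
      rw [Finset.sum_add_distrib, ← Finset.mul_sum, b.sum_coord_apply_eq_one]
      simp [hrdef]
    set w : Pt := ∑ i, (c i + r * b.coord i 0) • b i with hwdef
    have hcw : ∀ i, b.coord i w - r * b.coord i 0 = c i := fun i => by
      rw [hwdef, coord_comb b _ hw]; ring
    have hfr : ∀ y, (∀ i, c i ≤ b.coord i y) → (∃ i, b.coord i y ≤ c i) →
        y ∈ frontier (scaledTranslate (Tri b) r w) := by
      rintro y h1 ⟨i, hi⟩
      rw [(isClosed_scaled b r hr w).frontier_eq]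
      refine ⟨?_, ?_⟩
      · rw [mem_scaled b r hr]; intro i; rw [hcw]; exact h1 i
      · rw [mem_interior_scaled b r hr]; intro h2
        have := h2 i
        rw [hcw] at this
        linarith
    refine ⟨r, hr, w, hfr u (fun i => min_le_left _ _) ?_, hfr v (fun i => min_le_right _ _) ?_,
      ?_⟩
    · obtain ⟨i, hi⟩ := exists_coord_le b u v
      exact ⟨i, le_min le_rfl hi⟩
    · obtain ⟨i, hi⟩ := exists_coord_le b v u
      exact ⟨i, le_min hi le_rfl⟩
    · intro x hx hxi
      rw [mem_interior_scaled b r hr] at hxi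
      exact h x hx fun i => by have := hxi i; rwa [hcw] at this

lemma genPos_of (b : AffineBasis (Fin 3) ℝ Pt) (S : Set Pt)
    (h : ∀ u ∈ S, ∀ v ∈ S, u ≠ v → ∀ i, b.coord i u ≠ b.coord i v) : GenPos b S := by
  intro u hu v hv huv i c hcon
  apply h u hu v hv huv (i + 2)
  have hv' : v = (c • (b (i + 1) - b i)) + u := by rw [← hcon]; simp
  have h1 : b.coord (i + 2) (b (i + 1)) = 0 := b.coord_apply_ne (by fin_cases i <;> decide)
  have h2 : b.coord (i + 2) (b i) = 0 := b.coord_apply_ne (by fin_cases i <;> decide)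
  have h3 : b (i + 1) - b i = (-1 : ℝ) • b i + b (i + 1) := by simp [sub_eq_neg_add]
  rw [hv', coord_smul_add, h3, coord_smul_add, h1, h2]
  ring

lemma tdAdj_symm {Δ S : Set Pt} {u v : Pt} (h : TDAdj Δ S u v) : TDAdj Δ S v u := by
  obtain ⟨h1, h2, h3, r, hr, w, h4, h5, h6⟩ := h
  exact ⟨h2, h1, h3.symm, r, hr, w, h5, h4, h6⟩

/-! ### The spiral configuration -/

/-- All order relations between the coordinates of the points `v 0, …, v N` and `t`. -/
structure Spiral (b : AffineBasis (Fin 3) ℝ Pt) (j : Fin 3) (v : ℕ → Pt) (t : Pt) (N : ℕ) :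
    Prop where
  H_lt : ∀ i m, i < m → m ≤ N → b.coord j (v i) < b.coord j (v m)
  A_odd : ∀ i m, i < m → m ≤ N → m % 2 = 1 → b.coord (j - 1) (v i) < b.coord (j - 1) (v m)
  B_odd : ∀ i m, i < m → m ≤ N → m % 2 = 1 → b.coord (j + 1) (v m) < b.coord (j + 1) (v i)
  A_even : ∀ i m, i < m → m ≤ N → m % 2 = 0 → b.coord (j - 1) (v m) < b.coord (j - 1) (v i)
  B_even : ∀ i m, i < m → m ≤ N → m % 2 = 0 → b.coord (j + 1) (v i) < b.coord (j + 1) (v m)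
  H_t : ∀ i, i ≤ N → b.coord j (v i) < b.coord j t
  A_t : ∀ i, i ≤ N → b.coord (j - 1) t < b.coord (j - 1) (v i)
  B_t : ∀ i, i ≤ N → b.coord (j + 1) t < b.coord (j + 1) (v i)

open Classical in
/-- The point set `{v 0, …, v n, t}`. -/
def spiralSet (v : ℕ → Pt) (t : Pt) (n : ℕ) : Finset Pt :=
  insert t ((Finset.range (n + 1)).image v)

lemma mem_spiralSet {v : ℕ → Pt} {t : Pt} {n : ℕ} {x : Pt} :
    x ∈ (↑(spiralSet v t n) : Set Pt) ↔ x = t ∨ ∃ i ≤ n, x = v i := by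
  simp only [spiralSet, Finset.coe_insert, Finset.coe_image, Finset.coe_range,
    Set.mem_insert_iff, Set.mem_image, Set.mem_Iio, Nat.lt_succ_iff]
  constructor
  · rintro (h | ⟨i, h, rfl⟩)
    · exact Or.inl h
    · exact Or.inr ⟨i, h, rfl⟩
  · rintro (h | ⟨i, h, rfl⟩)
    · exact Or.inl h
    · exact Or.inr ⟨i, h, rfl⟩

lemma fin3_a (j : Fin 3) : j + 1 + 1 = j - 1 := by revert j; decide

lemma fin3_b (j : Fin 3) : j - 1 - 1 = j + 1 := by revert j; decide

lemma forall_fin3 (j : Fin 3) (P : Fin 3 → Prop) :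
    (∀ i, P i) ↔ P j ∧ P (j - 1) ∧ P (j + 1) := by
  constructor
  · intro h; exact ⟨h _, h _, h _⟩
  · rintro ⟨h1, h2, h3⟩ i
    have : i = j ∨ i = j - 1 ∨ i = j + 1 := by clear h1 h2 h3; revert i j; decide
    rcases this with rfl | rfl | rfl <;> assumption

section
variable {b : AffineBasis (Fin 3) ℝ Pt} {j : Fin 3} {v : ℕ → Pt} {t : Pt} {N : ℕ}

lemma Spiral.coord_ne (h : Spiral b j v t N) {i m : ℕ} (him : i < m) (hm : m ≤ N) (l : Fin 3) :
    b.coord l (v i) ≠ b.coord l (v m) := by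
  revert l
  rw [forall_fin3 j]
  refine ⟨(h.H_lt i m him hm).ne, ?_, ?_⟩
  · rcases Nat.mod_two_eq_zero_or_one m with hp | hp
    · exact (h.A_even i m him hm hp).ne'
    · exact (h.A_odd i m him hm hp).ne
  · rcases Nat.mod_two_eq_zero_or_one m with hp | hp
    · exact (h.B_even i m him hm hp).ne
    · exact (h.B_odd i m him hm hp).ne'

lemma Spiral.coord_ne_t (h : Spiral b j v t N) {i : ℕ} (hi : i ≤ N) (l : Fin 3) :
    b.coord l (v i) ≠ b.coord l t := by
  revert l
  rw [forall_fin3 j]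
  exact ⟨(h.H_t i hi).ne, (h.A_t i hi).ne', (h.B_t i hi).ne'⟩

lemma Spiral.ne_t (h : Spiral b j v t N) {i : ℕ} (hi : i ≤ N) : v i ≠ t :=
  fun e => h.coord_ne_t hi j (by rw [e])

lemma Spiral.ne (h : Spiral b j v t N) {i m : ℕ} (him : i < m) (hm : m ≤ N) : v i ≠ v m :=
  fun e => h.coord_ne him hm j (by rw [e])

lemma Spiral.genPos (h : Spiral b j v t N) {n : ℕ} (hn : n ≤ N) :
    GenPos b ↑(spiralSet v t n) := by
  apply genPos_of
  intro x hx y hy hxy l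
  rw [mem_spiralSet] at hx hy
  rcases hx with rfl | ⟨i, hi, rfl⟩ <;> rcases hy with rfl | ⟨m, hm, rfl⟩
  · exact absurd rfl hxy
  · exact (h.coord_ne_t (hm.trans hn) l).symm
  · exact h.coord_ne_t (hi.trans hn) l
  · rcases lt_trichotomy i m with hlt | rfl | hlt
    · exact h.coord_ne hlt (hm.trans hn) l
    · exact absurd rfl hxy
    · exact (h.coord_ne hlt (hi.trans hn) l).symm

lemma Spiral.adj_iff (h : Spiral b j v t N) {n : ℕ} (hn : n ≤ N) {i m : ℕ} (him : i < m)
    (hm : m ≤ n) : TDAdj (Tri b) ↑(spiralSet v t n) (v i) (v m) ↔ m ≤ i + 2 := by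
  have hmN := hm.trans hn
  rw [tdAdj_iff]
  constructor
  · rintro ⟨-, -, -, hd⟩
    by_contra! hlt
    apply hd (v (m - 2)) (mem_spiralSet.2 (Or.inr ⟨m - 2, by omega, rfl⟩))
    rw [forall_fin3 j]
    refine ⟨min_lt_of_left_lt (h.H_lt _ _ (by omega) (by omega)), ?_, ?_⟩
    · rcases Nat.mod_two_eq_zero_or_one m with hp | hp
      · exact min_lt_of_right_lt (h.A_even _ _ (by omega) (by omega) hp)
      · exact min_lt_of_left_lt (h.A_odd _ _ (by omega) (by omega) (by omega))
    · rcases Nat.mod_two_eq_zero_or_one m with hp | hp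
      · exact min_lt_of_left_lt (h.B_even _ _ (by omega) (by omega) (by omega))
      · exact min_lt_of_right_lt (h.B_odd _ _ (by omega) (by omega) hp)
  · intro hle
    refine ⟨mem_spiralSet.2 (Or.inr ⟨i, by omega, rfl⟩), mem_spiralSet.2 (Or.inr ⟨m, hm, rfl⟩),
      h.ne him hmN, ?_⟩
    intro x hx hdom
    rw [forall_fin3 j] at hdom
    obtain ⟨dH, dA, dB⟩ := hdom
    rw [mem_spiralSet] at hx
    rcases hx with rfl | ⟨l, hl, rfl⟩
    · have := h.A_t i (by omega)
      have := h.A_t m (by omega)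
      rcases min_lt_iff.1 dA with h' | h' <;> linarith
    · have hil : i < l := by
        by_contra! hli
        have h1 : b.coord j (v l) ≤ b.coord j (v i) := by
          rcases hli.eq_or_lt with rfl | hlt
          · exact le_rfl
          · exact (h.H_lt _ _ hlt (by omega)).le
        have h2 := h.H_lt _ _ him hmN
        rcases min_lt_iff.1 dH with h' | h' <;> linarith
      have hlm : l ≠ m := by
        rintro rfl
        rcases Nat.mod_two_eq_zero_or_one l with hp | hp
        · have := h.A_even _ _ him hmN hp
          rcases min_lt_iff.1 dA with h' | h' <;> linarith
        · have := h.B_odd _ _ him hmN hp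
          rcases min_lt_iff.1 dB with h' | h' <;> linarith
      rcases Nat.mod_two_eq_zero_or_one l with hp | hp
      · -- `l` even: `A (v l) < A (v i)`
        have h1 := h.A_even _ _ hil (by omega) hp
        have h2 : b.coord (j - 1) (v m) < b.coord (j - 1) (v l) := by
          rcases min_lt_iff.1 dA with h' | h'
          · linarith
          · exact h'
        rcases lt_or_gt_of_ne hlm with hlt | hlt
        · have : m % 2 = 1 := by omega
          have := h.A_odd _ _ hlt (by omega) this
          linarith
        · have := h.A_even _ _ hlt (by omega) hp
          linarith
      · have h1 := h.B_odd _ _ hil (by omega) hp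
        have h2 : b.coord (j + 1) (v m) < b.coord (j + 1) (v l) := by
          rcases min_lt_iff.1 dB with h' | h'
          · linarith
          · exact h'
        rcases lt_or_gt_of_ne hlm with hlt | hlt
        · have : m % 2 = 0 := by omega
          have := h.B_even _ _ hlt (by omega) this
          linarith
        · have := h.B_odd _ _ hlt (by omega) hp
          linarith

lemma Spiral.adj_t (h : Spiral b j v t N) {n : ℕ} (hn : n ≤ N) {x : Pt}
    (hx : TDAdj (Tri b) ↑(spiralSet v t n) x t) : x = v n := by
  rw [tdAdj_iff] at hx
  obtain ⟨hx, -, hne, hd⟩ := hx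
  rw [mem_spiralSet] at hx
  rcases hx with rfl | ⟨i, hi, rfl⟩
  · exact absurd rfl hne
  · rcases hi.eq_or_lt with rfl | hlt
    · rfl
    · exfalso
      apply hd (v n) (mem_spiralSet.2 (Or.inr ⟨n, le_rfl, rfl⟩))
      rw [forall_fin3 j]
      exact ⟨min_lt_of_left_lt (h.H_lt _ _ hlt hn), min_lt_of_right_lt (h.A_t _ hn),
        min_lt_of_right_lt (h.B_t _ hn)⟩

/-- The neighbours of `v i` for `i < n` are `v m` with `|i - m| ≤ 2`. -/
lemma Spiral.adj_left (h : Spiral b j v t N) {n : ℕ} (hn : n ≤ N) {i : ℕ} (hi : i < n) {x : Pt}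
    (hx : TDAdj (Tri b) ↑(spiralSet v t n) (v i) x) :
    ∃ m ≤ n, x = v m ∧ m ≤ i + 2 ∧ i ≤ m + 2 ∧ i ≠ m := by
  have hxS := hx.2.1
  rw [mem_spiralSet] at hxS
  rcases hxS with rfl | ⟨m, hm, rfl⟩
  · exact absurd (h.adj_t hn hx) (h.ne hi hn)
  · refine ⟨m, hm, rfl, ?_⟩
    rcases lt_trichotomy i m with hlt | rfl | hlt
    · have := (h.adj_iff hn hlt hm).1 hx
      omega
    · exact absurd rfl hx.2.2.1
    · have := (h.adj_iff hn hlt hi.le).1 (tdAdj_symm hx)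
      omega

lemma Spiral.adj_transfer (h : Spiral b j v t N) {n n' : ℕ} (hn : n ≤ N) (hn' : n' ≤ N) {i m : ℕ}
    (hi : i ≤ n) (hm : m ≤ n) (hi' : i ≤ n') (hm' : m ≤ n')
    (hx : TDAdj (Tri b) ↑(spiralSet v t n) (v i) (v m)) :
    TDAdj (Tri b) ↑(spiralSet v t n') (v i) (v m) := by
  rcases lt_trichotomy i m with hlt | rfl | hlt
  · exact (h.adj_iff hn' hlt hm').2 ((h.adj_iff hn hlt hm).1 hx)
  · exact absurd rfl hx.2.2.1
  · exact tdAdj_symm ((h.adj_iff hn' hlt hi').2 ((h.adj_iff hn hlt hi).1 (tdAdj_symm hx)))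

lemma Spiral.adj_s (h : Spiral b j v t N) {n : ℕ} (hn : n ≤ N) (h2 : 2 ≤ n) (x : Pt) :
    TDAdj (Tri b) ↑(spiralSet v t n) (v 0) x ↔ (x = v 1 ∨ x = v 2) := by
  constructor
  · intro hx
    obtain ⟨m, -, rfl, h1, -, h3⟩ := h.adj_left hn (by omega) hx
    have : m = 1 ∨ m = 2 := by omega
    rcases this with rfl | rfl <;> simp
  · rintro (rfl | rfl)
    · exact (h.adj_iff hn (by omega) (by omega)).2 (by omega)
    · exact (h.adj_iff hn (by omega) (by omega)).2 (by omega)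

lemma Spiral.chain_transfer (h : Spiral b j v t N) {n n' K : ℕ} (hn : n ≤ N) (hn' : n' ≤ N)
    (hK : K < n) (hK' : K < n') (P : List Pt) : ∀ (i : ℕ), i + 2 * P.length ≤ K →
    List.IsChain (TDAdj (Tri b) ↑(spiralSet v t n)) (v i :: P) →
    List.IsChain (TDAdj (Tri b) ↑(spiralSet v t n')) (v i :: P) ∧
      ∃ m ≤ K, (v i :: P).getLast? = some (v m) := by
  induction P with
  | nil =>
    intro i hi _
    exact ⟨List.isChain_singleton _, i, by simpa using hi, rfl⟩
  | cons x P ih =>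
    intro i hi hc
    rw [List.isChain_cons_cons] at hc
    simp only [List.length_cons] at hi
    obtain ⟨m, hm, rfl, h1, h2, h3⟩ := h.adj_left hn (by omega) hc.1
    obtain ⟨h4, l, hl, h5⟩ := ih m (by omega) hc.2
    refine ⟨List.isChain_cons_cons.2 ⟨?_, h4⟩, l, hl, ?_⟩
    · exact h.adj_transfer hn hn' (by omega) (by omega) (by omega) (by omega) hc.1
    · rw [List.getLast?_cons_cons]; exact h5

lemma Spiral.reach_sub (h : Spiral b j v t N) {n n' k : ℕ} (hn : n ≤ N) (hn' : n' ≤ N)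
    (hK : 2 * k < n) (hK' : 2 * k < n') {x : Pt}
    (hx : x ∈ ReachK (TDAdj (Tri b) ↑(spiralSet v t n)) k (v 0)) :
    x ∈ ReachK (TDAdj (Tri b) ↑(spiralSet v t n')) k (v 0) ∧ ∃ m ≤ 2 * k, x = v m := by
  obtain ⟨P, ⟨h1, h2, h3, h4⟩, h5⟩ := hx
  cases P with
  | nil => exact absurd rfl h1
  | cons a P =>
    simp only [List.head?_cons, Option.some.injEq] at h2
    subst h2
    simp only [List.length_cons] at h5
    obtain ⟨h6, m, hm, h7⟩ := h.chain_transfer hn hn' hK hK' P 0 (by omega) h4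
    refine ⟨⟨_, ⟨h1, rfl, h3, h6⟩, by simpa using h5⟩, m, hm, ?_⟩
    rw [h3] at h7
    exact Option.some.inj h7

lemma pathLength_nonneg : ∀ P : List Pt, 0 ≤ pathLength P
  | [] => le_rfl
  | [_] => le_rfl
  | a :: b :: rest => add_nonneg (norm_nonneg _) (pathLength_nonneg (b :: rest))

lemma Spiral.length_t (h : Spiral b j v t N) {n : ℕ} (hn : n ≤ N) (P : List Pt) : ∀ (x : Pt),
    x ≠ t → List.IsChain (TDAdj (Tri b) ↑(spiralSet v t n)) (x :: P) →
    (x :: P).getLast? = some t → ‖x - v n‖ + ‖v n - t‖ ≤ pathLength (x :: P) := by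
  induction P with
  | nil =>
    intro x hx _ hl
    exact absurd (by simpa using hl) hx
  | cons y P ih =>
    intro x hx hc hl
    rw [List.isChain_cons_cons] at hc
    rw [List.getLast?_cons_cons] at hl
    simp only [pathLength]
    by_cases hy : y = t
    · subst hy
      have := h.adj_t hn hc.1
      subst this
      have := pathLength_nonneg (y :: P)
      simpa using this
    · have := ih y hy hc.2 hl
      have h2 := norm_sub_le_norm_sub_add_norm_sub x y (v n)
      linarith

lemma Spiral.length_s (h : Spiral b j v t N) {n : ℕ} (hn : n ≤ N) {p : Pt} (hp : p ≠ t)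
    {P : List Pt} (hP : IsPathFrom (TDAdj (Tri b) ↑(spiralSet v t n)) (v 0) t P)
    (hp2 : P.tail.head? = some p) :
    ‖v 0 - p‖ + ‖p - v n‖ + ‖v n - t‖ ≤ pathLength P := by
  obtain ⟨h1, h2, h3, h4⟩ := hP
  match P, h1, h2, h3, h4, hp2 with
  | [_], _, _, _, _, hp2 => simp at hp2
  | a :: c :: P, _, h2, h3, h4, hp2 =>
    simp only [List.head?_cons, Option.some.injEq, List.tail_cons] at h2 hp2
    subst h2
    subst hp2
    have h4' := List.isChain_cons_cons.1 h4
    rw [List.getLast?_cons_cons] at h3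
    have := h.length_t hn P c hp h4'.2 h3
    simp only [pathLength]
    linarith

end

/-! ### Trigonometry -/

lemma trig_key (x y : ℝ) : Real.sin x ^ 2 + Real.sin y ^ 2 +
    2 * Real.sin x * Real.sin y * Real.cos (x + y) = Real.sin (x + y) ^ 2 := by
  rw [Real.sin_add, Real.cos_add]
  have h1 := Real.sin_sq_add_cos_sq x
  have h2 := Real.sin_sq_add_cos_sq y
  have e1 : Real.cos x ^ 2 = 1 - Real.sin x ^ 2 := by linarith
  have e2 : Real.cos y ^ 2 = 1 - Real.sin y ^ 2 := by linarith
  linear_combination (-(Real.sin y ^ 2)) * e1 - (Real.sin x ^ 2) * e2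

lemma trig_sum (α y z : ℝ) : Real.sin α * Real.sin y + Real.sin (α + y + z) * Real.sin z =
    Real.sin (α + z) * Real.sin (y + z) := by
  have h2 := Real.sin_sq_add_cos_sq z
  have e2 : Real.cos z ^ 2 = 1 - Real.sin z ^ 2 := by linarith
  simp only [Real.sin_add, Real.cos_add]
  linear_combination (-(Real.sin α * Real.sin y)) * e2

lemma geom (t a b : Pt) (x y z α : ℝ) (ht : EuclideanGeometry.angle b t a = x)
    (hb : EuclideanGeometry.angle a b t = y) (ha : EuclideanGeometry.angle t a b = z)
    (hx : 0 < x) (hy : 0 < y) (hz : 0 < z) (hsum : x + y + z = Real.pi)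
    (hα : α ∈ Set.Ioo 0 x) :
    ∃ l ∈ Set.Ioo (0 : ℝ) 1, ∀ s : Pt, s = l • a + (1 - l) • b →
      (Real.sin (x - α) / Real.sin y + Real.sin α / Real.sin z +
        min (Real.sin α / Real.sin z + Real.sin (α + z) / Real.sin y)
          (Real.sin (x - α) / Real.sin y + Real.sin (α + z) / Real.sin z)) * ‖s - t‖ =
      min (‖s - a‖ + ‖a - b‖ + ‖b - t‖) (‖s - b‖ + ‖b - a‖ + ‖a - t‖) := by
  obtain ⟨hα0, hα1⟩ := hα
  have sx : 0 < Real.sin x := Real.sin_pos_of_pos_of_lt_pi hx (by linarith)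
  have sy : 0 < Real.sin y := Real.sin_pos_of_pos_of_lt_pi hy (by linarith)
  have sz : 0 < Real.sin z := Real.sin_pos_of_pos_of_lt_pi hz (by linarith)
  have sα : 0 < Real.sin α := Real.sin_pos_of_pos_of_lt_pi hα0 (by linarith)
  have sxα : 0 < Real.sin (x - α) := Real.sin_pos_of_pos_of_lt_pi (by linarith) (by linarith)
  have sαz : 0 < Real.sin (α + z) := Real.sin_pos_of_pos_of_lt_pi (by linarith) (by linarith)
  -- law of sines
  have l1 : Real.sin y * ‖b - t‖ = Real.sin z * ‖a - t‖ := by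
    have := EuclideanGeometry.law_sin a b t
    rw [hb, ha, dist_eq_norm, dist_eq_norm, norm_sub_rev t a] at this
    exact this
  have l2 : Real.sin x * ‖a - t‖ = Real.sin y * ‖a - b‖ := by
    have := EuclideanGeometry.law_sin b t a
    rw [ht, hb, dist_eq_norm, dist_eq_norm, norm_sub_rev t a] at this
    exact this
  obtain ⟨ρ, hρ⟩ : ∃ ρ, ρ = ‖a - t‖ / Real.sin y := ⟨_, rfl⟩
  have hρ0 : 0 ≤ ρ := by rw [hρ]; positivity
  have da : ‖a - t‖ = ρ * Real.sin y := by rw [hρ]; field_simp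
  have db : ‖b - t‖ = ρ * Real.sin z := by
    rw [da] at l1; apply mul_left_cancel₀ sy.ne'; linarith
  have dab : ‖a - b‖ = ρ * Real.sin x := by
    rw [da] at l2; apply mul_left_cancel₀ sy.ne'; linarith
  obtain ⟨X, hX⟩ : ∃ X, X = Real.sin α / Real.sin z := ⟨_, rfl⟩
  obtain ⟨Y, hY⟩ : ∃ Y, Y = Real.sin (x - α) / Real.sin y := ⟨_, rfl⟩
  have hX0 : 0 < X := by rw [hX]; positivity
  have hY0 : 0 < Y := by rw [hY]; positivity
  have hXY : (X + Y) * (Real.sin y * Real.sin z) = Real.sin (α + z) * Real.sin x := by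
    have h1 := trig_sum α y z
    have h2 : Real.sin (α + y + z) = Real.sin (x - α) := by
      rw [← Real.sin_pi_sub]; congr 1; linarith
    have h3 : Real.sin (y + z) = Real.sin x := by
      rw [← Real.sin_pi_sub]; congr 1; linarith
    rw [h2, h3] at h1
    rw [hX, hY]; field_simp; linarith
  refine ⟨Y / (X + Y), ⟨by positivity, by rw [div_lt_one (by positivity)]; linarith⟩, ?_⟩
  intro s hs
  have hl : 1 - Y / (X + Y) = X / (X + Y) := by field_simp; ring
  rw [hl] at hs
  have hsa : s - a = (X / (X + Y)) • (b - a) := by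
    rw [hs, show Y / (X + Y) = 1 - X / (X + Y) by linarith]; module
  have hsb : s - b = (Y / (X + Y)) • (a - b) := by
    rw [hs, ← hl]; module
  have nsa : ‖s - a‖ = X / (X + Y) * (ρ * Real.sin x) := by
    rw [hsa, norm_smul, norm_sub_rev, dab, Real.norm_of_nonneg (by positivity)]
  have nsb : ‖s - b‖ = Y / (X + Y) * (ρ * Real.sin x) := by
    rw [hsb, norm_smul, dab, Real.norm_of_nonneg (by positivity)]
  have hst : (X + Y) • (s - t) = Y • (a - t) + X • (b - t) := by
    have h1 : s - t = (Y / (X + Y)) • (a - t) + (X / (X + Y)) • (b - t) := by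
      have : t = (Y / (X + Y) + X / (X + Y)) • t := by
        rw [← hl]; simp
      nth_rw 1 [this]
      rw [hs]; module
    rw [h1, smul_add, smul_smul, smul_smul, mul_div_cancel₀ _ (by positivity),
      mul_div_cancel₀ _ (by positivity)]
  have hinner : inner ℝ (a - t) (b - t) = Real.cos x * (‖a - t‖ * ‖b - t‖) := by
    have := InnerProductGeometry.cos_angle_mul_norm_mul_norm (a - t) (b - t)
    rw [← this, ← ht, EuclideanGeometry.angle_comm]
    rfl
  have nst2 : ((X + Y) * ‖s - t‖) ^ 2 = (ρ * Real.sin x) ^ 2 := by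
    have h1 : (X + Y) * ‖s - t‖ = ‖Y • (a - t) + X • (b - t)‖ := by
      rw [← hst, norm_smul, Real.norm_of_nonneg (by positivity)]
    rw [h1, norm_add_sq_real, norm_smul, norm_smul, real_inner_smul_left, real_inner_smul_right,
      hinner, Real.norm_of_nonneg hX0.le, Real.norm_of_nonneg hY0.le, da, db]
    have hk := trig_key (x - α) α
    rw [sub_add_cancel] at hk
    have e1 : Y * Real.sin y = Real.sin (x - α) := by rw [hY]; field_simp
    have e2 : X * Real.sin z = Real.sin α := by rw [hX]; field_simp
    rw [← e1, ← e2] at hk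
    linear_combination ρ ^ 2 * hk
  have nst : (X + Y) * ‖s - t‖ = ρ * Real.sin x :=
    (pow_left_inj₀ (by positivity) (by positivity) two_ne_zero).1 nst2
  have nst' : ‖s - t‖ = ρ * Real.sin x / (X + Y) := by
    rw [← nst]; field_simp
  have q1 : X * ‖s - t‖ = ‖s - a‖ := by rw [nsa, nst']; ring
  have q2 : Y * ‖s - t‖ = ‖s - b‖ := by rw [nsb, nst']; ring
  have q3 : Real.sin (α + z) / Real.sin y * ‖s - t‖ = ‖b - t‖ := by
    rw [db]
    apply mul_left_cancel₀ (mul_pos (mul_pos sy sx) (add_pos hX0 hY0)).ne'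
    have : Real.sin y * Real.sin x * (X + Y) * (Real.sin (α + z) / Real.sin y * ‖s - t‖) =
        Real.sin x * Real.sin (α + z) * ((X + Y) * ‖s - t‖) := by field_simp
    rw [this, nst]
    linear_combination (-(ρ * Real.sin x)) * hXY
  have q4 : Real.sin (α + z) / Real.sin z * ‖s - t‖ = ‖a - t‖ := by
    rw [da]
    apply mul_left_cancel₀ (mul_pos (mul_pos sz sx) (add_pos hX0 hY0)).ne'
    have : Real.sin z * Real.sin x * (X + Y) * (Real.sin (α + z) / Real.sin z * ‖s - t‖) =
        Real.sin x * Real.sin (α + z) * ((X + Y) * ‖s - t‖) := by field_simp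
    rw [this, nst]
    linear_combination (-(ρ * Real.sin x)) * hXY
  rw [← hX, ← hY, add_mul, min_mul_of_nonneg _ _ (norm_nonneg _), ← min_add_add_left]
  rw [norm_sub_rev b a, dab, ← nst, ← q1, ← q2, ← q3, ← q4]
  congr 1 <;> ring

lemma exists_Cexpr (θ : Fin 3 → ℝ) (hpos : ∀ j, 0 < θ j) (ε : ℝ) (hε : 0 < ε) :
    ∃ j, ∃ α ∈ Set.Ioo 0 (θ j), Cval θ - ε < Cexpr θ j α := by
  have h : Cval θ - ε < Cval θ := by linarith
  have hne : { x : ℝ | ∃ j : Fin 3, ∃ α : ℝ, α ∈ Set.Icc 0 (θ j) ∧ x = Cexpr θ j α }.Nonempty :=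
    ⟨Cexpr θ 0 0, 0, 0, ⟨le_rfl, (hpos 0).le⟩, rfl⟩
  obtain ⟨_, ⟨j, α, hα, rfl⟩, hlt⟩ := exists_lt_of_lt_csSup hne h
  refine ⟨j, ?_⟩
  have hc : Continuous (Cexpr θ j) := by
    unfold Cexpr
    fun_prop
  have ho : IsOpen {α | Cval θ - ε < Cexpr θ j α} := isOpen_lt continuous_const hc
  rw [← closure_Ioo (hpos j).ne] at hα
  obtain ⟨β, h1, h2⟩ := mem_closure_iff.1 hα _ ho hlt
  exact ⟨β, h2, h1⟩

/-! ### The explicit points -/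

/-- The point with given barycentric coordinates. -/
def bpt (b : AffineBasis (Fin 3) ℝ Pt) (j : Fin 3) (h a c : ℝ) : Pt :=
  h • b j + a • b (j - 1) + c • b (j + 1)

lemma bpt_coord (b : AffineBasis (Fin 3) ℝ Pt) (j : Fin 3) (h a c : ℝ) (hs : h + a + c = 1) :
    b.coord j (bpt b j h a c) = h ∧ b.coord (j - 1) (bpt b j h a c) = a ∧
      b.coord (j + 1) (bpt b j h a c) = c := by
  have e : bpt b j h a c =
      ∑ i, (if i = j then h else if i = j - 1 then a else c : ℝ) • b i := by
    unfold bpt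
    fin_cases j <;> simp [Fin.sum_univ_three, show (-1 : Fin 3) = 2 from rfl] <;> abel
  have hsum : ∑ i, (if i = j then h else if i = j - 1 then a else c : ℝ) = 1 := by
    rw [← hs]
    fin_cases j <;> simp [Fin.sum_univ_three, show (-1 : Fin 3) = 2 from rfl] <;> ring
  rw [e, coord_comb b _ hsum, coord_comb b _ hsum, coord_comb b _ hsum]
  fin_cases j <;> simp [show (-1 : Fin 3) = 2 from rfl]

/-- The spiral points. -/
def vpt (b : AffineBasis (Fin 3) ℝ Pt) (j : Fin 3) (l M d : ℝ) (i : ℕ) : Pt :=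
  if i = 0 then bpt b j 0 l (1 - l)
  else if i % 2 = 1 then bpt b j (d * i) (1 - 2 * (d * M) + d * i) (2 * (d * M) - 2 * (d * i))
  else bpt b j (d * i) (2 * (d * M) - 2 * (d * i)) (1 - 2 * (d * M) + d * i)

lemma spiral_vpt (b : AffineBasis (Fin 3) ℝ Pt) (j : Fin 3) (l d : ℝ) (N M : ℕ) (hNM : N < M)
    (hd : 0 < d) (h1 : 2 * (d * M) < l) (h2 : 2 * (d * M) < 1 - l) :
    Spiral b j (vpt b j l M d) (b j) N := by
  have mono : ∀ i m : ℕ, i < m → d * (i : ℝ) < d * m := fun i m h =>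
    mul_lt_mul_of_pos_left (by exact_mod_cast h) hd
  have c0 := bpt_coord b j 0 l (1 - l) (by ring)
  have co : ∀ i : ℕ, _ := fun i : ℕ => bpt_coord b j (d * i) (1 - 2 * (d * M) + d * i)
    (2 * (d * M) - 2 * (d * i)) (by ring)
  have ce : ∀ i : ℕ, _ := fun i : ℕ => bpt_coord b j (d * i) (2 * (d * M) - 2 * (d * i))
    (1 - 2 * (d * M) + d * i) (by ring)
  have v0 : vpt b j l M d 0 = bpt b j 0 l (1 - l) := by simp [vpt]
  have vo : ∀ i, i % 2 = 1 → vpt b j l M d i = bpt b j (d * i) (1 - 2 * (d * M) + d * i)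
      (2 * (d * M) - 2 * (d * i)) := fun i hi => by
    have : i ≠ 0 := by omega
    simp [vpt, this, hi]
  have ve : ∀ i, i ≠ 0 → i % 2 = 0 → vpt b j l M d i =
      bpt b j (d * i) (2 * (d * M) - 2 * (d * i)) (1 - 2 * (d * M) + d * i) := fun i hi hi' => by
    simp [vpt, hi, hi']
  have kind : ∀ i, i = 0 ∨ i % 2 = 1 ∨ (i ≠ 0 ∧ i % 2 = 0) := fun i => by omega
  have nn : ∀ i : ℕ, 0 ≤ d * (i : ℝ) := fun i => by positivity
  have t1 : b.coord j (b j) = 1 := b.coord_apply_eq j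
  have t2 : b.coord (j - 1) (b j) = 0 := b.coord_apply_ne (by fin_cases j <;> decide)
  have t3 : b.coord (j + 1) (b j) = 0 := b.coord_apply_ne (by fin_cases j <;> decide)
  constructor
  · intro i m him hm
    have a1 := mono i m him
    have a2 := mono m M (by omega)
    have a3 := nn i
    have hm0 : m ≠ 0 := by omega
    rcases kind i with rfl | hi | ⟨hi0, hi⟩ <;> rcases kind m with hm' | hm' | ⟨-, hm'⟩
    all_goals first
      | exact absurd hm' hm0
      | (simp only [v0, vo _ hm', c0, co]; linarith)
      | (simp only [v0, ve _ hm0 hm', c0, ce]; linarith)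
      | (simp only [vo _ hi, vo _ hm', co]; linarith)
      | (simp only [vo _ hi, ve _ hm0 hm', co, ce]; linarith)
      | (simp only [ve _ hi0 hi, vo _ hm', co, ce]; linarith)
      | (simp only [ve _ hi0 hi, ve _ hm0 hm', ce]; linarith)
  · intro i m him hm hm'
    have a1 := mono i m him
    have a2 := mono m M (by omega)
    have a3 := nn i
    rw [vo _ hm', (co m).2.1]
    rcases kind i with rfl | hi | ⟨hi0, hi⟩
    · rw [v0, c0.2.1]; linarith [nn m]
    · rw [vo _ hi, (co i).2.1]; linarith
    · rw [ve _ hi0 hi, (ce i).2.1]; linarith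
  · intro i m him hm hm'
    have a1 := mono i m him
    have a2 := mono m M (by omega)
    have a3 := nn i
    rw [vo _ hm', (co m).2.2]
    rcases kind i with rfl | hi | ⟨hi0, hi⟩
    · rw [v0, c0.2.2]; linarith [nn m]
    · rw [vo _ hi, (co i).2.2]; linarith
    · rw [ve _ hi0 hi, (ce i).2.2]; linarith
  · intro i m him hm hm'
    have a1 := mono i m him
    have a2 := mono m M (by omega)
    have a3 := nn i
    rw [ve _ (by omega) hm', (ce m).2.1]
    rcases kind i with rfl | hi | ⟨hi0, hi⟩
    · rw [v0, c0.2.1]; linarith [nn m]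
    · rw [vo _ hi, (co i).2.1]; linarith
    · rw [ve _ hi0 hi, (ce i).2.1]; linarith
  · intro i m him hm hm'
    have a1 := mono i m him
    have a2 := mono m M (by omega)
    have a3 := nn i
    rw [ve _ (by omega) hm', (ce m).2.2]
    rcases kind i with rfl | hi | ⟨hi0, hi⟩
    · rw [v0, c0.2.2]; linarith [nn m]
    · rw [vo _ hi, (co i).2.2]; linarith
    · rw [ve _ hi0 hi, (ce i).2.2]; linarith
  · intro i hi'
    have a2 := mono i M (by omega)
    rw [t1]
    rcases kind i with rfl | hi | ⟨hi0, hi⟩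
    · rw [v0, c0.1]; linarith
    · rw [vo _ hi, (co i).1]; linarith [nn M]
    · rw [ve _ hi0 hi, (ce i).1]; linarith [nn M]
  · intro i hi'
    have a2 := mono i M (by omega)
    have a3 := nn i
    rw [t2]
    rcases kind i with rfl | hi | ⟨hi0, hi⟩
    · rw [v0, c0.2.1]; linarith [nn M]
    · rw [vo _ hi, (co i).2.1]; linarith
    · rw [ve _ hi0 hi, (ce i).2.1]; linarith
  · intro i hi'
    have a2 := mono i M (by omega)
    have a3 := nn i
    rw [t3]
    rcases kind i with rfl | hi | ⟨hi0, hi⟩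
    · rw [v0, c0.2.2]; linarith [nn M]
    · rw [vo _ hi, (co i).2.2]; linarith
    · rw [ve _ hi0 hi, (ce i).2.2]; linarith

lemma continuous_vpt (b : AffineBasis (Fin 3) ℝ Pt) (j : Fin 3) (l M : ℝ) (i : ℕ) :
    Continuous fun d => vpt b j l M d i := by
  unfold vpt bpt
  split_ifs <;> fun_prop

lemma vpt_zero_odd (b : AffineBasis (Fin 3) ℝ Pt) (j : Fin 3) (l M : ℝ) (i : ℕ) (hi : i % 2 = 1) :
    vpt b j l M 0 i = b (j - 1) := by
  have : i ≠ 0 := by omega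
  simp [vpt, bpt, hi, this]

lemma vpt_zero_even (b : AffineBasis (Fin 3) ℝ Pt) (j : Fin 3) (l M : ℝ) (i : ℕ) (hi : i % 2 = 0)
    (hi0 : i ≠ 0) : vpt b j l M 0 i = b (j + 1) := by
  simp [vpt, bpt, hi, hi0]

/-- For every `k ≥ 1` and `ε > 0` there are two point sets `S₁, S₂` in
general position whose `TD_{θ₁,θ₂}`-Delaunay graphs `G₁, G₂` agree on the
`k`-neighbourhood of `s`, in which `s` has exactly the two neighbours `p` and `q`, and
such that any path from `s` to `t` starting with edge `sp` in `G₁`, or starting with edge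
`sq` in `G₂`, has length at least `(C(θ₁,θ₂) − ε)·‖s − t‖`. -/
theorem k_local_routing_lower_bound_instances
    (θ : Fin 3 → ℝ) (hθ0 : 0 < θ 0) (hθ01 : θ 0 ≤ θ 1) (hθ12 : θ 1 ≤ θ 2)
    (hsum : θ 0 + θ 1 + θ 2 = Real.pi)
    (τ : Fin 3 → Pt) (hncol : ¬ Collinear ℝ (Set.range τ))
    (hangle : ∀ j : Fin 3, EuclideanGeometry.angle (τ (j + 1)) (τ j) (τ (j - 1)) = θ j)
    (k : ℕ) (hk : 0 < k) (ε : ℝ) (hε : 0 < ε) :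
    ∃ S₁ S₂ : Finset Pt, GenPos τ ↑S₁ ∧ GenPos τ ↑S₂ ∧
      ∃ s t p q : Pt, ({s, t, p, q} : Set Pt) ⊆ ↑S₁ ∩ ↑S₂ ∧ s ≠ t ∧
        -- (i) identical k-neighbourhoods of s, with identical adjacency inside them
        ReachK (TDAdj (Tri τ) ↑S₁) k s = ReachK (TDAdj (Tri τ) ↑S₂) k s ∧
        (∀ u ∈ ReachK (TDAdj (Tri τ) ↑S₁) k s, ∀ v ∈ ReachK (TDAdj (Tri τ) ↑S₁) k s,
          (TDAdj (Tri τ) ↑S₁ u v ↔ TDAdj (Tri τ) ↑S₂ u v)) ∧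
        -- (ii) the neighbours of s are exactly p and q, in both graphs
        (∀ x : Pt, TDAdj (Tri τ) ↑S₁ s x ↔ (x = p ∨ x = q)) ∧
        (∀ x : Pt, TDAdj (Tri τ) ↑S₂ s x ↔ (x = p ∨ x = q)) ∧
        -- (iii) paths in G₁ whose first edge is sp are long
        (∀ P : List Pt, IsPathFrom (TDAdj (Tri τ) ↑S₁) s t P → P.tail.head? = some p →
          (Cval θ - ε) * ‖s - t‖ ≤ pathLength P) ∧
        -- (iv) paths in G₂ whose first edge is sq are long
        (∀ P : List Pt, IsPathFrom (TDAdj (Tri τ) ↑S₂) s t P → P.tail.head? = some q →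
          (Cval θ - ε) * ‖s - t‖ ≤ pathLength P) := by
  have hind : AffineIndependent ℝ τ := affineIndependent_iff_not_collinear.2 hncol
  have htot : affineSpan ℝ (Set.range τ) = ⊤ := by
    rw [hind.affineSpan_eq_top_iff_card_eq_finrank_add_one]
    simp
  obtain ⟨b, rfl⟩ : ∃ b : AffineBasis (Fin 3) ℝ Pt, ⇑b = τ := ⟨⟨τ, hind, htot⟩, rfl⟩
  have hpos : ∀ j, 0 < θ j := by
    intro j
    fin_cases j
    · exact hθ0
    · exact lt_of_lt_of_le hθ0 hθ01
    · exact lt_of_lt_of_le hθ0 (hθ01.trans hθ12)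
  obtain ⟨j, α, hα, hC⟩ := exists_Cexpr θ hpos ε hε
  have hs3 : θ j + θ (j + 1) + θ (j - 1) = Real.pi := by
    rw [← hsum]
    fin_cases j
    · rfl
    · show θ 1 + θ 2 + θ 0 = _
      ring
    · show θ 2 + θ 0 + θ 1 = _
      ring
  have hangb : EuclideanGeometry.angle (b (j - 1)) (b (j + 1)) (b j) = θ (j + 1) := by
    have := hangle (j + 1)
    rwa [fin3_a j, add_sub_cancel_right] at this
  have hanga : EuclideanGeometry.angle (b j) (b (j - 1)) (b (j + 1)) = θ (j - 1) := by
    have := hangle (j - 1)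
    rwa [fin3_b j, sub_add_cancel] at this
  obtain ⟨l, ⟨hl0, hl1⟩, hgeom⟩ := geom (b j) (b (j - 1)) (b (j + 1)) (θ j) (θ (j + 1)) (θ (j - 1)) α
    (hangle j) hangb hanga (hpos _) (hpos _) (hpos _) hs3 hα
  set n : ℕ := 2 * k + 2 with hn
  set M : ℕ := n + 2 with hM
  obtain ⟨s, hs⟩ : ∃ s, s = l • b (j - 1) + (1 - l) • b (j + 1) := ⟨_, rfl⟩
  have hv0 : ∀ d, vpt b j l M d 0 = s := fun d => by simp [vpt, bpt, hs]
  have hst : s ≠ b j := by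
    intro e
    have h1 := (bpt_coord b j 0 l (1 - l) (by ring)).1
    have h2 : bpt b j 0 l (1 - l) = b j := by rw [← e, hs]; simp [bpt]
    rw [h2, b.coord_apply_eq] at h1
    norm_num at h1
  have hnorm : 0 < ‖s - b j‖ := norm_pos_iff.2 (sub_ne_zero.2 hst)
  have hlt := mul_lt_mul_of_pos_right hC hnorm
  have hg := hgeom s hs
  unfold Cexpr at hlt
  rw [hg, lt_min_iff] at hlt
  -- choose the parameter `d`
  have ev1 : ∀ᶠ d in nhds (0 : ℝ), 2 * (d * M) < l :=
    (by fun_prop : Continuous fun d : ℝ => 2 * (d * M)).continuousAt.eventually_lt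
      continuousAt_const (by simpa using hl0)
  have ev2 : ∀ᶠ d in nhds (0 : ℝ), 2 * (d * M) < 1 - l :=
    (by fun_prop : Continuous fun d : ℝ => 2 * (d * M)).continuousAt.eventually_lt
      continuousAt_const (by simpa using hl1)
  have cv := continuous_vpt b j l M
  have ev3 : ∀ᶠ d in nhds (0 : ℝ), (Cval θ - ε) * ‖s - b j‖ <
      ‖s - vpt b j l M d 1‖ + ‖vpt b j l M d 1 - vpt b j l M d n‖ + ‖vpt b j l M d n - b j‖ := by
    refine continuousAt_const.eventually_lt (Continuous.continuousAt ?_) ?_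
    · have := cv 1
      have := cv n
      fun_prop
    · rw [vpt_zero_odd b j l M 1 rfl, vpt_zero_even b j l M n (by omega) (by omega)]
      exact hlt.1
  have ev4 : ∀ᶠ d in nhds (0 : ℝ), (Cval θ - ε) * ‖s - b j‖ <
      ‖s - vpt b j l M d 2‖ + ‖vpt b j l M d 2 - vpt b j l M d (n + 1)‖ +
        ‖vpt b j l M d (n + 1) - b j‖ := by
    refine continuousAt_const.eventually_lt (Continuous.continuousAt ?_) ?_
    · have := cv 2
      have := cv (n + 1)
      fun_prop
    · rw [vpt_zero_even b j l M 2 rfl (by omega), vpt_zero_odd b j l M (n + 1) (by omega)]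
      exact hlt.2
  obtain ⟨d, ⟨⟨h1, h2, h3, h4⟩, hd⟩⟩ :=
    ((((ev1.and (ev2.and (ev3.and ev4))).filter_mono nhdsWithin_le_nhds).and
      (self_mem_nhdsWithin : Set.Ioi (0 : ℝ) ∈ nhdsWithin 0 (Set.Ioi 0)))).exists
  have hS : Spiral b j (vpt b j l M d) (b j) (n + 1) :=
    spiral_vpt b j l d (n + 1) M (by omega) hd h1 h2
  have hsv := hv0 d
  set v := vpt b j l M d with hv
  rw [← hsv] at h3 h4
  have reach : ReachK (TDAdj (Tri b) ↑(spiralSet v (b j) n)) k (v 0) =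
      ReachK (TDAdj (Tri b) ↑(spiralSet v (b j) (n + 1))) k (v 0) := by
    ext x
    exact ⟨fun h => (hS.reach_sub (by omega) le_rfl (by omega) (by omega) h).1,
      fun h => (hS.reach_sub le_rfl (by omega) (by omega) (by omega) h).1⟩
  refine ⟨spiralSet v (b j) n, spiralSet v (b j) (n + 1), hS.genPos (by omega), hS.genPos le_rfl,
    v 0, b j, v 1, v 2, ?_, hS.ne_t (by omega), reach, ?_, hS.adj_s (by omega) (by omega),
    hS.adj_s le_rfl (by omega), ?_, ?_⟩
  · intro x hx
    rw [Set.mem_inter_iff, mem_spiralSet, mem_spiralSet]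
    simp only [Set.mem_insert_iff, Set.mem_singleton_iff] at hx
    rcases hx with rfl | rfl | rfl | rfl
    · exact ⟨Or.inr ⟨0, by omega, rfl⟩, Or.inr ⟨0, by omega, rfl⟩⟩
    · exact ⟨Or.inl rfl, Or.inl rfl⟩
    · exact ⟨Or.inr ⟨1, by omega, rfl⟩, Or.inr ⟨1, by omega, rfl⟩⟩
    · exact ⟨Or.inr ⟨2, by omega, rfl⟩, Or.inr ⟨2, by omega, rfl⟩⟩
  · intro x hx y hy
    obtain ⟨-, i, hi, rfl⟩ := hS.reach_sub (by omega) le_rfl (by omega) (by omega) hx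
    obtain ⟨-, m, hm, rfl⟩ := hS.reach_sub (by omega) le_rfl (by omega) (by omega) hy
    exact ⟨hS.adj_transfer (by omega) le_rfl (by omega) (by omega) (by omega) (by omega),
      hS.adj_transfer le_rfl (by omega) (by omega) (by omega) (by omega) (by omega)⟩
  · intro P hP hp
    exact h3.le.trans (hS.length_s (by omega) (hS.ne_t (by omega)) hP hp)
  · intro P hP hp
    exact h4.le.trans (hS.length_s le_rfl (hS.ne_t (by omega)) hP hp)
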